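/- arXiv:1511.07533 — 5 statements merged into one kernel-verified Lean document; each statement's English description precedes it below -/
import Mathlib

section
/- Let k ≥ 1, let β_1,...,β_k ≥ 0 and c_1,...,c_k ∈ [0,1], let β ≥ 0 and c ∈ [0,1], and let Q be a real number with Q ≥ Σ_{m=1}^k β_m + Σ_{i≠j, i,j≤k} √(β_i β_j)·c_i·c_j. Then β + Q + 2c·√(β·Q) ≥ β + Σ_{m=1}^k β_m + Σ_{i≠j, i,j≤k+1} √(β'_i β'_j)·c'_i·c'_j, where β'_m = β_m and c'_m = c_m for m ≤ k, β'_{k+1} = β, c'_{k+1} = c, and Σ_{i≠j} denotes the sum over all ordered pairs with i ≠ j. -/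
open Real Finset

theorem offDiag_aux (n : ℕ) (b c : ℕ → ℝ) (hb : ∀ m ∈ Finset.range n, 0 ≤ b m) :
    ∑ p ∈ (Finset.range n).offDiag, Real.sqrt (b p.1 * b p.2) * c p.1 * c p.2
      = (∑ i ∈ Finset.range n, Real.sqrt (b i) * c i) ^ 2
        - ∑ i ∈ Finset.range n, b i * c i ^ 2 := by
  have h1 : ∑ p ∈ (Finset.range n).offDiag, Real.sqrt (b p.1 * b p.2) * c p.1 * c p.2
      = ∑ p ∈ (Finset.range n).offDiag,
        (Real.sqrt (b p.1) * c p.1) * (Real.sqrt (b p.2) * c p.2) := by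
    refine Finset.sum_congr rfl fun p hp => ?_
    rw [Real.sqrt_mul (hb _ (Finset.mem_offDiag.1 hp).1)]
    ring
  have h2 : ∑ i ∈ Finset.range n, b i * c i ^ 2 = ∑ p ∈ (Finset.range n).diag,
        (Real.sqrt (b p.1) * c p.1) * (Real.sqrt (b p.2) * c p.2) := by
    rw [Finset.sum_diag]
    refine Finset.sum_congr rfl fun i hi => ?_
    have := Real.mul_self_sqrt (hb i hi)
    linear_combination (-c i ^ 2) * this
  rw [h1, h2, sq, Finset.sum_mul_sum, ← Finset.sum_product', ← Finset.diag_union_offDiag,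
    Finset.sum_union (Finset.disjoint_diag_offDiag _)]
  ring

/-- Inductive step of Proposition 1: adding one more ET preserves the lower bound. -/
theorem inductive_step (k : ℕ) (hk : 1 ≤ k) (β c : ℕ → ℝ)
    (hβ : ∀ m ∈ Finset.range k, 0 ≤ β m)
    (hc : ∀ m ∈ Finset.range k, c m ∈ Set.Icc (0:ℝ) 1)
    (βn cn : ℝ) (hβn : 0 ≤ βn) (hcn : cn ∈ Set.Icc (0:ℝ) 1)
    (Q : ℝ)
    (hQ : Q ≥ ∑ m ∈ Finset.range k, β m
        + ∑ p ∈ (Finset.range k).offDiag, Real.sqrt (β p.1 * β p.2) * c p.1 * c p.2)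
    (β' c' : ℕ → ℝ)
    (hβ'eq : ∀ m ∈ Finset.range k, β' m = β m) (hβ'new : β' k = βn)
    (hc'eq : ∀ m ∈ Finset.range k, c' m = c m) (hc'new : c' k = cn) :
    βn + Q + 2 * cn * Real.sqrt (βn * Q)
      ≥ βn + ∑ m ∈ Finset.range k, β m
        + ∑ p ∈ (Finset.range (k + 1)).offDiag,
            Real.sqrt (β' p.1 * β' p.2) * c' p.1 * c' p.2 := by
  have hb' : ∀ m ∈ Finset.range (k + 1), 0 ≤ β' m := by
    intro m hm
    rcases Nat.lt_succ_iff_lt_or_eq.1 (Finset.mem_range.1 hm) with h | h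
    · rw [hβ'eq m (Finset.mem_range.2 h)]
      exact hβ m (Finset.mem_range.2 h)
    · rw [h, hβ'new]
      exact hβn
  rw [offDiag_aux k β c hβ] at hQ
  rw [offDiag_aux (k + 1) β' c' hb', Finset.sum_range_succ, Finset.sum_range_succ, hβ'new, hc'new,
    Finset.sum_congr rfl (fun i hi => by rw [hβ'eq i hi, hc'eq i hi] :
      ∀ i ∈ Finset.range k, Real.sqrt (β' i) * c' i = Real.sqrt (β i) * c i),
    Finset.sum_congr rfl (fun i hi => by rw [hβ'eq i hi, hc'eq i hi] :
      ∀ i ∈ Finset.range k, β' i * c' i ^ 2 = β i * c i ^ 2)]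
  have hle : ∑ i ∈ Finset.range k, β i * c i ^ 2 ≤ ∑ i ∈ Finset.range k, β i := by
    refine Finset.sum_le_sum fun i hi => ?_
    exact mul_le_of_le_one_right (hβ i hi) (pow_le_one₀ (hc i hi).1 (hc i hi).2)
  set S := ∑ i ∈ Finset.range k, Real.sqrt (β i) * c i
  have hS : S ≤ Real.sqrt Q := Real.le_sqrt_of_sq_le (by linarith)
  have h3 := mul_le_mul_of_nonneg_left hS (mul_nonneg hcn.1 (Real.sqrt_nonneg βn))
  rw [Real.sqrt_mul hβn]
  have h4 := Real.mul_self_sqrt hβn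
  have h5 : (S + Real.sqrt βn * cn) ^ 2 = S ^ 2 + 2 * (cn * Real.sqrt βn * S) + βn * cn ^ 2 := by
    linear_combination cn ^ 2 * h4
  rw [h5]
  linarith
end

section
/- Let M ≥ 2, let β_1,...,β_M ≥ 0, and let e_1,...,e_M be real numbers with e_1 = 0 and cos(e_m) ≥ 0 for all m. Define Q^(1) = β_1 and Q^(k+1) = β_{k+1} + Q^(k) + 2·cos(e_{k+1})·√(β_{k+1}·Q^(k)) for 1 ≤ k ≤ M−1. Then Q^(M) ≥ Σ_{m=1}^M β_m + Σ_{i≠j} √(β_i β_j)·cos(e_i)·cos(e_j), where Σ_{i≠j} denotes the sum over all ordered pairs (i,j) with i ≠ j. -/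
open Real Finset

/-- Core inequality of Proposition 1: the sequentially-built harvested power dominates
the quadratic-form lower bound. ETs are indexed 1,...,M. -/
theorem harvested_power_lower_bound (M : ℕ) (hM : 2 ≤ M) (β e : ℕ → ℝ)
    (hβ : ∀ m ∈ Finset.Icc 1 M, 0 ≤ β m)
    (he1 : e 1 = 0)
    (hcos : ∀ m ∈ Finset.Icc 1 M, 0 ≤ Real.cos (e m))
    (Q : ℕ → ℝ) (hQ1 : Q 1 = β 1)
    (hQrec : ∀ k, 1 ≤ k → k ≤ M - 1 →
        Q (k + 1) = β (k + 1) + Q k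
          + 2 * Real.cos (e (k + 1)) * Real.sqrt (β (k + 1) * Q k)) :
    Q M ≥ ∑ m ∈ Finset.Icc 1 M, β m
        + ∑ p ∈ (Finset.Icc 1 M).offDiag,
            Real.sqrt (β p.1 * β p.2) * Real.cos (e p.1) * Real.cos (e p.2) := by
  have key : ∀ k, 1 ≤ k → k ≤ M →
      (∑ m ∈ Finset.Icc 1 k, √(β m) * Real.cos (e m)) ^ 2
        + ∑ m ∈ Finset.Icc 1 k, β m * (1 - Real.cos (e m) ^ 2) ≤ Q k := by
    intro k hk
    induction k, hk using Nat.le_induction with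
    | base =>
      intro h
      have hb := hβ 1 (by simp; omega)
      simp [he1, hQ1, Real.sq_sqrt hb]
    | succ k hk ih =>
      intro h
      have ih := ih (by omega)
      rw [hQrec k hk (by omega), Finset.sum_Icc_succ_top (by omega),
        Finset.sum_Icc_succ_top (by omega)]
      have hb := hβ (k + 1) (by simp; omega)
      have hc := hcos (k + 1) (by simp; omega)
      have hT : 0 ≤ ∑ m ∈ Finset.Icc 1 k, β m * (1 - Real.cos (e m) ^ 2) := by
        apply Finset.sum_nonneg
        intro m hm
        have hm' := Finset.mem_Icc.1 hm
        have := hβ m (by simp; omega)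
        have h2 := Real.cos_sq_le_one (e m)
        exact mul_nonneg this (by linarith)
      rw [Real.sqrt_mul hb]
      set S := ∑ m ∈ Finset.Icc 1 k, √(β m) * Real.cos (e m)
      have hS : S ≤ √(Q k) := Real.le_sqrt_of_sq_le (by linarith)
      have h3 := mul_le_mul_of_nonneg_left hS (mul_nonneg hc (Real.sqrt_nonneg (β (k + 1))))
      have h4 := Real.sq_sqrt hb
      have h5 : (√(β (k + 1)) * Real.cos (e (k + 1))) ^ 2
          = β (k + 1) * Real.cos (e (k + 1)) ^ 2 := by rw [mul_pow, h4]
      nlinarith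
  have hM' := key M (by omega) le_rfl
  have hsq : (∑ m ∈ Finset.Icc 1 M, √(β m) * Real.cos (e m)) ^ 2
      = ∑ m ∈ Finset.Icc 1 M, β m * Real.cos (e m) ^ 2
        + ∑ p ∈ (Finset.Icc 1 M).offDiag,
            Real.sqrt (β p.1 * β p.2) * Real.cos (e p.1) * Real.cos (e p.2) := by
    rw [sq, Finset.sum_mul_sum, ← Finset.sum_product', ← Finset.diag_union_offDiag,
      Finset.sum_union (Finset.disjoint_diag_offDiag _), Finset.sum_diag]
    congr 1
    · apply Finset.sum_congr rfl
      intro m hm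
      have := Real.sq_sqrt (hβ m hm)
      calc _ = √(β m) ^ 2 * Real.cos (e m) ^ 2 := by ring
        _ = _ := by rw [this]
    · apply Finset.sum_congr rfl
      intro p hp
      rw [Real.sqrt_mul (hβ _ (Finset.mem_offDiag.1 hp).1)]
      ring
  simp only [mul_sub, mul_one, Finset.sum_sub_distrib] at hM'
  linarith
end

section
/- Let M ≥ 2 and N ≥ 1, let β_1,...,β_M ≥ 0, and let e_1,...,e_M be real numbers with e_1 = 0 and |e_m| ≤ π/2^N for all m. Define Q^(1) = β_1 and Q^(k+1) = β_{k+1} + Q^(k) + 2·cos(e_{k+1})·√(β_{k+1}·Q^(k)) for 1 ≤ k ≤ M−1. Then Q^(M) ≥ Σ_{m=1}^M β_m + ( Σ_{i≠j} √(β_i β_j) )·cos²(π/2^N), where Σ_{i≠j} denotes the sum over all ordered pairs (i,j) with i ≠ j. Consequently, if Q* := Σ_m β_m + Σ_{i≠j} √(β_i β_j) > 0, the efficiency η = Q^(M)/Q* satisfies η ≥ (1/Q*)·( Σ_m β_m + (Σ_{i≠j} √(β_i β_j))·cos²(π/2^N) ). -/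
open Real Finset

/-- Proposition 1: lower bound on the harvested power and on the efficiency of the
distributed EB scheme with N one-bit feedback intervals per ET. ETs are indexed 1,...,M. -/
theorem proposition1 (M N : ℕ) (hM : 2 ≤ M) (hN : 1 ≤ N) (β e : ℕ → ℝ)
    (hβ : ∀ m ∈ Finset.Icc 1 M, 0 ≤ β m)
    (he1 : e 1 = 0)
    (he : ∀ m ∈ Finset.Icc 1 M, |e m| ≤ π / 2 ^ N)
    (Q : ℕ → ℝ) (hQ1 : Q 1 = β 1)
    (hQrec : ∀ k, 1 ≤ k → k ≤ M - 1 →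
        Q (k + 1) = β (k + 1) + Q k
          + 2 * Real.cos (e (k + 1)) * Real.sqrt (β (k + 1) * Q k)) :
    Q M ≥ ∑ m ∈ Finset.Icc 1 M, β m
        + (∑ p ∈ (Finset.Icc 1 M).offDiag, Real.sqrt (β p.1 * β p.2))
            * Real.cos (π / 2 ^ N) ^ 2
    ∧ ((∑ m ∈ Finset.Icc 1 M, β m
          + ∑ p ∈ (Finset.Icc 1 M).offDiag, Real.sqrt (β p.1 * β p.2)) > 0 →
        Q M / (∑ m ∈ Finset.Icc 1 M, β m
            + ∑ p ∈ (Finset.Icc 1 M).offDiag, Real.sqrt (β p.1 * β p.2))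
          ≥ (1 / (∑ m ∈ Finset.Icc 1 M, β m
              + ∑ p ∈ (Finset.Icc 1 M).offDiag, Real.sqrt (β p.1 * β p.2)))
            * (∑ m ∈ Finset.Icc 1 M, β m
              + (∑ p ∈ (Finset.Icc 1 M).offDiag, Real.sqrt (β p.1 * β p.2))
                  * Real.cos (π / 2 ^ N) ^ 2)) := by
  have hpi := Real.pi_pos
  have h2 : (2:ℝ) ≤ 2 ^ N := by
    calc (2:ℝ) = 2 ^ 1 := by norm_num
      _ ≤ 2 ^ N := pow_le_pow_right₀ (by norm_num) hN
  have hθ : π / 2 ^ N ≤ π / 2 := div_le_div_of_nonneg_left hpi.le (by norm_num) h2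
  have hθ0 : 0 ≤ π / 2 ^ N := by positivity
  have hc0 : 0 ≤ Real.cos (π / 2 ^ N) :=
    Real.cos_nonneg_of_neg_pi_div_two_le_of_le (by linarith) hθ
  have hc1 : Real.cos (π / 2 ^ N) ≤ 1 := Real.cos_le_one _
  have hce : ∀ m ∈ Finset.Icc 1 M, Real.cos (π / 2 ^ N) ≤ Real.cos (e m) := by
    intro m hm
    rw [← Real.cos_abs (e m)]
    exact Real.cos_le_cos_of_nonneg_of_le_pi (abs_nonneg _) (by linarith) (he m hm)
  set c := Real.cos (π / 2 ^ N) with hc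
  have hoff : ∑ p ∈ (Finset.Icc 1 M).offDiag, Real.sqrt (β p.1 * β p.2)
      = (∑ m ∈ Finset.Icc 1 M, √(β m)) ^ 2 - ∑ m ∈ Finset.Icc 1 M, β m := by
    have hd : ∑ p ∈ (Finset.Icc 1 M).diag, Real.sqrt (β p.1 * β p.2)
        = ∑ m ∈ Finset.Icc 1 M, β m := by
      rw [Finset.sum_diag]
      exact Finset.sum_congr rfl fun m hm => Real.sqrt_mul_self (hβ m hm)
    have hp : ∑ p ∈ (Finset.Icc 1 M) ×ˢ (Finset.Icc 1 M), Real.sqrt (β p.1 * β p.2)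
        = (∑ m ∈ Finset.Icc 1 M, √(β m)) ^ 2 := by
      rw [sq, Finset.sum_mul_sum, Finset.sum_product]
      exact Finset.sum_congr rfl fun i hi => Finset.sum_congr rfl fun j _ =>
        Real.sqrt_mul (hβ i hi) _
    rw [← hp, ← hd, ← Finset.diag_union_offDiag,
      Finset.sum_union (Finset.disjoint_diag_offDiag _)]
    ring
  have key : ∀ k, 1 ≤ k → k ≤ M → Q k ≥ ∑ m ∈ Finset.Icc 1 k, β m
      + ((∑ m ∈ Finset.Icc 1 k, √(β m)) ^ 2 - ∑ m ∈ Finset.Icc 1 k, β m) * c ^ 2 := by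
    intro k hk
    induction k, hk using Nat.le_induction with
    | base =>
      intro _
      have := Real.sq_sqrt (hβ 1 (by simp; omega))
      simp [hQ1, this]
    | succ k hk ih =>
      intro hkM
      have ih := ih (by omega)
      have hmem : k + 1 ∈ Finset.Icc 1 M := by simp; omega
      have hb := hβ _ hmem
      rw [hQrec k hk (by omega), Finset.sum_Icc_succ_top (by omega),
        Finset.sum_Icc_succ_top (by omega), Real.sqrt_mul hb]
      have hB : 0 ≤ ∑ m ∈ Finset.Icc 1 k, β m :=
        Finset.sum_nonneg fun m hm => hβ m (by simp at hm ⊢; omega)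
      have hS : 0 ≤ ∑ m ∈ Finset.Icc 1 k, √(β m) :=
        Finset.sum_nonneg fun m _ => Real.sqrt_nonneg _
      generalize ∑ m ∈ Finset.Icc 1 k, β m = B at *
      generalize ∑ m ∈ Finset.Icc 1 k, √(β m) = S at *
      have hsq := Real.sq_sqrt hb
      have hs := Real.sqrt_nonneg (β (k + 1))
      have hq : c * S ≤ √(Q k) := by
        apply Real.le_sqrt_of_sq_le
        have : 0 ≤ B * (1 - c ^ 2) := mul_nonneg hB (by nlinarith)
        nlinarith
      have h1 : c * (√(β (k+1)) * (c * S)) ≤ Real.cos (e (k+1)) * (√(β (k+1)) * √(Q k)) :=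
        mul_le_mul (hce _ hmem) (mul_le_mul_of_nonneg_left hq hs) (by positivity)
          (hc0.trans (hce _ hmem))
      have h3 : (S + √(β (k+1))) ^ 2 - (B + β (k+1)) = S ^ 2 - B + 2 * S * √(β (k+1)) := by
        linear_combination hsq
      rw [h3]
      linarith
  have main := key M (by omega) le_rfl
  rw [← hoff] at main
  refine ⟨main, fun hpos => ?_⟩
  rw [ge_iff_le, one_div, inv_mul_eq_div]
  exact div_le_div_of_nonneg_right main hpos.le
end

section
/- Let A ≥ 0, B > 0, and η̂ ∈ (0,1] be reals such that x := η̂ − (1−η̂)·A/B satisfies 0 ≤ x < 1. If a natural number N satisfies N ≥ log₂( π / arccos(√x) ), then A + B·cos²(π/2^N) ≥ η̂·(A + B); equivalently, the efficiency lower bound ( A + B·cos²(π/2^N) )/(A+B) of Proposition 1 is at least η̂. -/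
open Real

/-- Corollary 1: sufficient number of feedback intervals to guarantee target efficiency. -/
theorem corollary1 (A B ηhat : ℝ) (hA : 0 ≤ A) (hB : 0 < B)
    (hη : ηhat ∈ Set.Ioc (0:ℝ) 1)
    (hx0 : 0 ≤ ηhat - (1 - ηhat) * A / B) (hx1 : ηhat - (1 - ηhat) * A / B < 1)
    (N : ℕ)
    (hN : (N : ℝ) ≥ Real.logb 2 (π / Real.arccos (Real.sqrt (ηhat - (1 - ηhat) * A / B)))) :
    A + B * Real.cos (π / 2 ^ N) ^ 2 ≥ ηhat * (A + B)
    ∧ (A + B * Real.cos (π / 2 ^ N) ^ 2) / (A + B) ≥ ηhat := by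
  have hAB : 0 < A + B := by linarith
  have key : A + B * Real.cos (π / 2 ^ N) ^ 2 ≥ ηhat * (A + B) := by
    obtain ⟨x, hx⟩ : ∃ x, x = ηhat - (1 - ηhat) * A / B := ⟨_, rfl⟩
    rw [← hx] at hx0 hx1 hN
    have hBx : B * x = ηhat * B - (1 - ηhat) * A := by
      rw [hx]; field_simp
    have hs1 : Real.sqrt x < 1 := by
      rw [Real.sqrt_lt' one_pos]; simpa using hx1
    have ha : 0 < Real.arccos (Real.sqrt x) := Real.arccos_pos.2 hs1
    have h2 : π / Real.arccos (Real.sqrt x) ≤ (2:ℝ) ^ N := by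
      have h := (Real.logb_le_iff_le_rpow (b := 2) (by norm_num) (div_pos Real.pi_pos ha)).1 hN
      rwa [Real.rpow_natCast] at h
    have h3 : π / 2 ^ N ≤ Real.arccos (Real.sqrt x) := by
      rw [div_le_iff₀ ha] at h2
      rw [div_le_iff₀ (by positivity)]
      linarith
    have h4 : Real.sqrt x ≤ Real.cos (π / 2 ^ N) := by
      have h := Real.cos_le_cos_of_nonneg_of_le_pi (by positivity) (Real.arccos_le_pi _) h3
      rwa [Real.cos_arccos (by linarith [Real.sqrt_nonneg x]) hs1.le] at h
    have h5 : x ≤ Real.cos (π / 2 ^ N) ^ 2 := by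
      have h := pow_le_pow_left₀ (Real.sqrt_nonneg x) h4 2
      rwa [Real.sq_sqrt hx0] at h
    have h6 := mul_le_mul_of_nonneg_left h5 hB.le
    linarith
  exact ⟨key, (le_div_iff₀ hAB).2 key⟩
end

section
/- Let M ≥ 2 be an integer and η̂ ∈ (0,1] a real with 0 ≤ (M·η̂ − 1)/(M−1) < 1. If a natural number N satisfies N ≥ log₂( π / arccos( √( (M·η̂ − 1)/(M−1) ) ) ), then ( 1 + (M−1)·cos²(π/2^N) ) / M ≥ η̂. -/
open Real

/-- Special case of Corollary 1 with identical channel gains. -/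
theorem corollary1_identical_gains (M : ℕ) (hM : 2 ≤ M) (ηhat : ℝ)
    (hη : ηhat ∈ Set.Ioc (0:ℝ) 1)
    (hx0 : 0 ≤ ((M : ℝ) * ηhat - 1) / ((M : ℝ) - 1))
    (hx1 : ((M : ℝ) * ηhat - 1) / ((M : ℝ) - 1) < 1)
    (N : ℕ)
    (hN : (N : ℝ) ≥ Real.logb 2
        (π / Real.arccos (Real.sqrt (((M : ℝ) * ηhat - 1) / ((M : ℝ) - 1))))) :
    (1 + ((M : ℝ) - 1) * Real.cos (π / 2 ^ N) ^ 2) / (M : ℝ) ≥ ηhat := by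
  have hM' : (2:ℝ) ≤ M := by exact_mod_cast hM
  have hM1 : (0:ℝ) < (M:ℝ) - 1 := by linarith
  set x := ((M : ℝ) * ηhat - 1) / ((M : ℝ) - 1) with hx
  have hxe : x * ((M:ℝ) - 1) = (M:ℝ) * ηhat - 1 := by
    rw [hx]; field_simp
  have hs1 : Real.sqrt x < 1 := by
    rw [Real.sqrt_lt' one_pos]; simpa using hx1
  have hs0 := Real.sqrt_nonneg x
  have ha : 0 < Real.arccos (Real.sqrt x) := Real.arccos_pos.2 hs1
  have hp : π / Real.arccos (Real.sqrt x) ≤ 2 ^ N := by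
    have h := (Real.logb_le_iff_le_rpow (by norm_num) (div_pos Real.pi_pos ha)).1 hN
    rwa [Real.rpow_natCast] at h
  have h2 : (0:ℝ) < 2 ^ N := by positivity
  have hle : π / 2 ^ N ≤ Real.arccos (Real.sqrt x) := by
    rw [div_le_iff₀ ha] at hp
    rw [div_le_iff₀ h2]
    linarith
  have hc : Real.sqrt x ≤ Real.cos (π / 2 ^ N) := by
    have h := Real.cos_le_cos_of_nonneg_of_le_pi (by positivity) (Real.arccos_le_pi _) hle
    rwa [Real.cos_arccos (by linarith) hs1.le] at h
  have hsq : x ≤ Real.cos (π / 2 ^ N) ^ 2 := by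
    rw [← Real.sq_sqrt hx0]
    exact pow_le_pow_left₀ hs0 hc 2
  rw [ge_iff_le, le_div_iff₀ (by linarith)]
  nlinarith [mul_le_mul_of_nonneg_right hsq hM1.le]
end
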